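/- Let X be a complete metric space with a geodesic structure σ that is Busemann convex, let n ≥ 1 be real, and suppose the n-dimensional Hausdorff measure μH n is locally finite, positive on every nonempty open set, and satisfies MCP(0,n) with respect to σ. Let q ∈ X and R > 0, and suppose geodesics from ball q R extend to length 9R with respect to σ. Then there exists C > 0 such that for every x ∈ ball q R and every r ∈ (0, R), μH n (ball x r) = C·r^n. -/

import Mathlib

open Metric MeasureTheory ENNReal Filter

/-- A geodesic structure on a metric space. -/
structure GeodesicStructure (X : Type*) [MetricSpace X] where
  σ : X → X → ℝ → X
  σ_zero : ∀ x y, σ x y 0 = x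
  σ_one : ∀ x y, σ x y 1 = y
  dist_σ : ∀ x y, ∀ s ∈ Set.Icc (0:ℝ) 1, ∀ t ∈ Set.Icc (0:ℝ) 1,
    dist (σ x y s) (σ x y t) = |s - t| * dist x y
  σ_comp : ∀ x y, ∀ s ∈ Set.Icc (0:ℝ) 1, ∀ t ∈ Set.Icc (0:ℝ) 1,
    σ x (σ x y t) s = σ x y (s * t)

/-- Busemann convexity of a geodesic structure. -/
def GeodesicStructure.BusemannConvex {X : Type*} [MetricSpace X]
    (G : GeodesicStructure X) : Prop :=
  ∀ p x y : X, ∀ t ∈ Set.Icc (0:ℝ) 1, dist (G.σ p x t) (G.σ p y t) ≤ t * dist x y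

/-- Geodesic completeness with respect to a geodesic structure. -/
def GeodesicStructure.GeodComplete {X : Type*} [MetricSpace X]
    (G : GeodesicStructure X) : Prop :=
  ∀ x y : X, x ≠ y → ∀ R : ℝ, dist x y ≤ R →
    ∃ z : X, dist x z = R ∧ G.σ x z (dist x y / R) = y

/-- The measure contraction property MCP(0,N) with respect to a geodesic structure. -/
def GeodesicStructure.MCPzero {X : Type*} [MetricSpace X] [MeasurableSpace X]
    (G : GeodesicStructure X) (m : Measure X) (N : ℝ) : Prop :=
  ∀ p : X, ∀ A : Set X, MeasurableSet A → ∀ t ∈ Set.Icc (0:ℝ) 1,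
    ENNReal.ofReal (t ^ N) * m A ≤ m ((fun x => G.σ p x t) '' A)

/-- Geodesics from `ball q R` extend to length `9R` with respect to `G`. -/
def ExtendsTo {X : Type*} [MetricSpace X] (G : GeodesicStructure X) (q : X) (R : ℝ) : Prop :=
  ∀ x ∈ Metric.ball q R, ∀ y : X, 0 < dist x y → dist x y ≤ 9 * R →
    ∀ s : ℝ, dist x y ≤ s → s ≤ 9 * R →
      ∃ z : X, dist x z = s ∧ G.σ x z (dist x y / s) = y

open Topology

namespace GeodesicStructure

variable {X : Type*} [MetricSpace X] (G : GeodesicStructure X)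

theorem dist_left_σ (x y : X) {t : ℝ} (ht : t ∈ Set.Icc (0:ℝ) 1) :
    dist x (G.σ x y t) = t * dist x y := by
  have h := G.dist_σ x y 0 (by simp) t ht
  rwa [G.σ_zero, zero_sub, abs_neg, abs_of_nonneg ht.1] at h

/-- Where geodesics extend, every smaller concentric ball is a contraction of the larger one. -/
theorem ball_subset_image_σ {q x : X} {R r t : ℝ} (hext : ExtendsTo G q R)
    (hx : x ∈ ball q R) (ht : t ∈ Set.Ioc (0:ℝ) 1) (hr : 0 < r) (hrR : r ≤ 9 * R) :
    ball x (t * r) ⊆ (fun z => G.σ x z t) '' ball x r := by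
  intro y hy
  rw [mem_ball, dist_comm] at hy
  rcases (dist_nonneg (x := x) (y := y)).eq_or_lt with h0 | h0
  · obtain rfl := dist_eq_zero.1 h0.symm
    refine ⟨x, mem_ball_self hr, ?_⟩
    have h := G.dist_left_σ x x (Set.Ioc_subset_Icc_self ht)
    rw [dist_self, mul_zero] at h
    exact (dist_eq_zero.1 h).symm
  · have hlt : dist x y / t < r := by rwa [div_lt_iff₀' ht.1]
    have hle : dist x y ≤ dist x y / t := le_div_self h0.le ht.1 ht.2
    obtain ⟨z, hz, hzy⟩ := hext x hx y h0 (by linarith) (dist x y / t) hle (by linarith)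
    refine ⟨z, by rwa [mem_ball, dist_comm, hz], ?_⟩
    rwa [div_div_cancel₀ h0.ne'] at hzy

theorem BusemannConvex.image_ball_subset {G : GeodesicStructure X} (hB : G.BusemannConvex)
    (p z : X) (r : ℝ) {t : ℝ} (ht : t ∈ Set.Ioc (0:ℝ) 1) :
    (fun x => G.σ p x t) '' ball z r ⊆ ball (G.σ p z t) (t * r) := by
  rintro _ ⟨x, hx, rfl⟩
  exact (hB p x z t (Set.Ioc_subset_Icc_self ht)).trans_lt (mul_lt_mul_of_pos_left hx ht.1)

variable [MeasurableSpace X] [BorelSpace X] {G}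

theorem BusemannConvex.hausdorffMeasure_image_le (hB : G.BusemannConvex) {n : ℝ} (hn : 0 ≤ n)
    (p : X) (A : Set X) {t : ℝ} (ht : t ∈ Set.Icc (0:ℝ) 1) :
    μH[n] ((fun x => G.σ p x t) '' A) ≤ ENNReal.ofReal (t ^ n) * μH[n] A := by
  have hL : LipschitzWith t.toNNReal (fun x => G.σ p x t) :=
    LipschitzWith.of_dist_le_mul fun x y => by
      simpa [Real.coe_toNNReal _ ht.1] using hB p x y t ht
  rw [← ENNReal.ofReal_rpow_of_nonneg ht.1 hn]
  exact hL.hausdorffMeasure_image_le hn A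

/-- The measure of a ball contracted towards any centre grows at least like `t ^ n`. -/
theorem MCPzero.measure_ball_le {m : Measure X} {n : ℝ} (hMCP : G.MCPzero m n)
    (hB : G.BusemannConvex) (p z : X) (r : ℝ) {t : ℝ} (ht : t ∈ Set.Ioc (0:ℝ) 1) :
    ENNReal.ofReal (t ^ n) * m (ball z r) ≤ m (ball (G.σ p z t) (t * r)) :=
  (hMCP p _ measurableSet_ball t (Set.Ioc_subset_Icc_self ht)).trans
    (measure_mono (hB.image_ball_subset p z r ht))

theorem MCPzero.hausdorffMeasure_ball_mul {n : ℝ} (hMCP : G.MCPzero μH[n] n)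
    (hB : G.BusemannConvex) (hn : 0 ≤ n) {q x : X} {R r t : ℝ} (hext : ExtendsTo G q R)
    (hx : x ∈ ball q R) (ht : t ∈ Set.Ioc (0:ℝ) 1) (hr : 0 < r) (hrR : r ≤ 9 * R) :
    μH[n] (ball x (t * r)) = ENNReal.ofReal (t ^ n) * μH[n] (ball x r) := by
  refine le_antisymm ((measure_mono (G.ball_subset_image_σ hext hx ht hr hrR)).trans
    (hB.hausdorffMeasure_image_le hn x _ (Set.Ioc_subset_Icc_self ht))) ?_
  have h := hMCP.measure_ball_le hB x x r ht
  have hfix : G.σ x x t = x := by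
    have h := G.dist_left_σ x x (Set.Ioc_subset_Icc_self ht)
    rw [dist_self, mul_zero] at h
    exact (dist_eq_zero.1 h).symm
  rwa [hfix] at h

theorem MCPzero.hausdorffMeasure_ball_eq_of_mem {n : ℝ} (hMCP : G.MCPzero μH[n] n)
    (hB : G.BusemannConvex) (hn : 0 ≤ n) {q x : X} {R r : ℝ} (hext : ExtendsTo G q R)
    (hx : x ∈ ball q R) (hr : 0 < r) (hrR : r ≤ R) :
    μH[n] (ball x r) = ENNReal.ofReal ((r / R) ^ n) * μH[n] (ball x R) := by
  have hR : 0 < R := hr.trans_le hrR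
  have h := hMCP.hausdorffMeasure_ball_mul hB hn hext hx (t := r / R)
    ⟨div_pos hr hR, (div_le_one hR).2 hrR⟩ hR (by linarith)
  rwa [div_mul_cancel₀ _ hR.ne'] at h

/-- Contracting `z` towards `p` does not decrease the volume of the balls of radius `R`, and that
volume is upper semicontinuous at `p`; hence it is at least as large at `p` as at `z`. -/
theorem MCPzero.hausdorffMeasure_ball_le {n : ℝ} (hMCP : G.MCPzero μH[n] n)
    (hB : G.BusemannConvex) (hn : 0 ≤ n) {q p z : X} {R : ℝ} (hR : 0 < R)
    (hext : ExtendsTo G q R) (hp : p ∈ ball q R) :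
    μH[n] (ball z R) ≤ μH[n] (ball p R) := by
  set D := dist p z
  have hbound : ∀ᶠ t : ℝ in 𝓝[>] 0,
      ENNReal.ofReal (((R - t * D) / R) ^ n) * μH[n] (ball z R) ≤ μH[n] (ball p R) := by
    have hlim : Tendsto (fun t : ℝ => t * D) (𝓝[>] 0) (𝓝 0) :=
      ((continuous_mul_const D).tendsto' 0 0 (zero_mul D)).mono_left nhdsWithin_le_nhds
    have hpq : 0 < R - dist p q := sub_pos.2 hp
    filter_upwards [self_mem_nhdsWithin, Ioc_mem_nhdsGT (zero_lt_one' ℝ),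
      hlim.eventually_lt_const hR, hlim.eventually_lt_const hpq] with t ht0 ht htR htq
    have hw : dist p (G.σ p z t) = t * D := G.dist_left_σ p z (Set.Ioc_subset_Icc_self ht)
    have hwq : G.σ p z t ∈ ball q R := by
      rw [mem_ball]
      have := dist_triangle_left (G.σ p z t) q p
      linarith
    have hzw : μH[n] (ball z R) ≤ μH[n] (ball (G.σ p z t) R) := by
      have h := hMCP.measure_ball_le hB p z R ht
      rw [hMCP.hausdorffMeasure_ball_mul hB hn hext hwq ht hR (by linarith)] at h
      exact (ENNReal.mul_le_mul_iff_right
        (ENNReal.ofReal_pos.2 (Real.rpow_pos_of_pos ht.1 n)).ne' ENNReal.ofReal_ne_top).1 h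
    have hD : 0 ≤ t * D := mul_nonneg ht.1.le dist_nonneg
    calc ENNReal.ofReal (((R - t * D) / R) ^ n) * μH[n] (ball z R)
        ≤ ENNReal.ofReal (((R - t * D) / R) ^ n) * μH[n] (ball (G.σ p z t) R) := by gcongr
      _ = μH[n] (ball (G.σ p z t) (R - t * D)) :=
        (hMCP.hausdorffMeasure_ball_eq_of_mem hB hn hext hwq (sub_pos.2 htR)
          (by linarith)).symm
      _ ≤ μH[n] (ball p R) := measure_mono (ball_subset_ball' (by
          rw [dist_comm, hw]; linarith))
  have hcoef : Tendsto (fun t : ℝ => ENNReal.ofReal (((R - t * D) / R) ^ n)) (𝓝[>] 0) (𝓝 1) := by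
    have hc : Continuous fun t : ℝ => ENNReal.ofReal (((R - t * D) / R) ^ n) :=
      ENNReal.continuous_ofReal.comp
        ((Real.continuous_rpow_const hn).comp (by fun_prop))
    exact (hc.tendsto' 0 1 (by simp [div_self hR.ne'])).mono_left nhdsWithin_le_nhds
  have hmul := ENNReal.Tendsto.mul_const (b := μH[n] (ball z R)) hcoef (Or.inl one_ne_zero)
  rw [one_mul] at hmul
  exact le_of_tendsto hmul hbound

theorem MCPzero.hausdorffMeasure_ball_ne_top {n : ℝ} (hMCP : G.MCPzero μH[n] n)
    [IsLocallyFiniteMeasure (μH[n] : Measure X)]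
    (hB : G.BusemannConvex) (hn : 0 ≤ n) {q x : X} {R : ℝ} (hR : 0 < R)
    (hext : ExtendsTo G q R) (hx : x ∈ ball q R) : μH[n] (ball x R) ≠ ∞ := by
  obtain ⟨s, hs, hfin⟩ := (μH[n] : Measure X).finiteAt_nhds x
  obtain ⟨δ, hδ, hsub⟩ := Metric.mem_nhds_iff.1 hs
  have hr : 0 < min δ R := lt_min hδ hR
  have hlt : μH[n] (ball x (min δ R)) < ∞ :=
    (measure_mono ((ball_subset_ball (min_le_left _ _)).trans hsub)).trans_lt hfin
  rw [hMCP.hausdorffMeasure_ball_eq_of_mem hB hn hext hx hr (min_le_right _ _)] at hlt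
  intro htop
  rw [htop, ENNReal.mul_top
    (ENNReal.ofReal_pos.2 (Real.rpow_pos_of_pos (div_pos hr hR) n)).ne'] at hlt
  exact lt_irrefl _ hlt

end GeodesicStructure

theorem busemann_mcp_local_ball_homogeneity
    (X : Type*) [MetricSpace X] [CompleteSpace X] [MeasurableSpace X] [BorelSpace X]
    (G : GeodesicStructure X) (hB : G.BusemannConvex)
    (n : ℝ) (hn : 1 ≤ n)
    (hlf : IsLocallyFiniteMeasure (μH[n] : Measure X))
    (hpos : (μH[n] : Measure X).IsOpenPosMeasure)
    (hMCP : G.MCPzero μH[n] n)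
    (q : X) (R : ℝ) (hR : 0 < R) (hext : ExtendsTo G q R) :
    ∃ C : ℝ, 0 < C ∧ ∀ x ∈ ball q R, ∀ r : ℝ, 0 < r → r < R →
      μH[n] (ball x r) = ENNReal.ofReal (C * r ^ n) := by
  have hn0 : 0 ≤ n := zero_le_one.trans hn
  have hq : q ∈ ball q R := mem_ball_self hR
  have hfin := hMCP.hausdorffMeasure_ball_ne_top hB hn0 hR hext hq
  have hVpos : 0 < (μH[n] (ball q R)).toReal :=
    ENNReal.toReal_pos (measure_ball_pos _ q hR).ne' hfin
  refine ⟨(μH[n] (ball q R)).toReal / R ^ n, div_pos hVpos (Real.rpow_pos_of_pos hR n), ?_⟩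
  intro x hx r hr hrR
  have hxq : μH[n] (ball x R) = μH[n] (ball q R) :=
    le_antisymm (hMCP.hausdorffMeasure_ball_le hB hn0 hR hext hq)
      (hMCP.hausdorffMeasure_ball_le hB hn0 hR hext hx)
  rw [hMCP.hausdorffMeasure_ball_eq_of_mem hB hn0 hext hx hr hrR.le, hxq,
    ← ENNReal.ofReal_toReal hfin, ← ENNReal.ofReal_mul (by positivity),
    Real.div_rpow hr.le hR.le, ENNReal.toReal_ofReal hVpos.le]
  congr 1
  ring
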